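/- In PG(5,3), the largest maximal partial line spread that is not a spread has size 88; that is, there exists a maximal partial line spread of size 88, and every maximal partial line spread of size greater than 88 has size 91 (the size of a spread), so the largest maximal partial line spread of positive deficiency has deficiency δ = (q+3)/2 = 3. -/

import Mathlib

/-- A partial line spread of PG(n-1, q): a set of lines (2-dimensional linear
subspaces of `F^n`) that are pairwise skew, i.e. pairwise intersecting only
in the zero subspace. -/
def IsPartialLineSpread (F : Type*) [Field F] (n : ℕ)
    (S : Set (Submodule F (Fin n → F))) : Prop :=
  (∀ l ∈ S, Module.finrank F ↥l = 2) ∧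
  (∀ l ∈ S, ∀ l' ∈ S, l ≠ l' → l ⊓ l' = ⊥)

/-- A maximal partial line spread: a partial line spread such that every line
of the space meets some line of the spread nontrivially (equivalently, it
cannot be extended to a larger partial line spread). -/
def IsMaximalPartialLineSpread (F : Type*) [Field F] (n : ℕ)
    (S : Set (Submodule F (Fin n → F))) : Prop :=
  IsPartialLineSpread F n S ∧
  ∀ m : Submodule F (Fin n → F), Module.finrank F ↥m = 2 → ∃ l ∈ S, m ⊓ l ≠ ⊥

theorem eq_zero_or_one_or_neg_one_of_card {F : Type*} [Field F] [Fintype F]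
    (hq : Fintype.card F = 3) (a : F) : a = 0 ∨ a = 1 ∨ a = -1 := by
  classical
  have : Fact (Nat.Prime 3) := ⟨Nat.prime_three⟩
  have : CharP F 3 := charP_of_card_eq_prime hq
  have h2 : (1 : F) ≠ -1 := by
    intro h
    have h2 : ((2 : ℕ) : F) = 0 := by
      push_cast
      linear_combination h
    rw [CharP.cast_eq_zero_iff F 3] at h2
    omega
  have h : ({0, 1, -1} : Finset F) = Finset.univ := by
    rw [← Finset.card_eq_iff_eq_univ, hq, Finset.card_eq_three]
    exact ⟨0, 1, -1, by simp, by simp [eq_comm], h2, rfl⟩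
  have := h ▸ Finset.mem_univ a
  simpa using this

section Counting

variable {F V : Type*} [Field F] [Fintype F] [AddCommGroup V] [Module F V]
open Classical

theorem card_filter_not_and_not {α : Type*} (s : Finset α) (P Q : α → Prop) :
    (s.filter fun a => ¬ P a ∧ ¬ Q a).card + (s.filter P).card + (s.filter Q).card
      = s.card + (s.filter fun a => P a ∧ Q a).card := by
  have h1 := Finset.card_filter_add_card_filter_not (s := s) P
  have h2 := Finset.card_filter_add_card_filter_not (s := s.filter P) Q
  have h3 := Finset.card_filter_add_card_filter_not (s := s.filter fun a => ¬ P a) Q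
  have h4 := Finset.card_filter_add_card_filter_not (s := s.filter Q) P
  simp only [Finset.filter_filter] at h2 h3 h4
  have e1 : (s.filter fun a => Q a ∧ P a) = s.filter fun a => P a ∧ Q a :=
    Finset.filter_congr fun _ _ => and_comm
  have e2 : (s.filter fun a => Q a ∧ ¬ P a) = s.filter fun a => ¬ P a ∧ Q a :=
    Finset.filter_congr fun _ _ => and_comm
  rw [e1, e2] at h4
  omega

theorem linearIndependent_pair_of_ne (hq : Fintype.card F = 3) {x y : V} (hx : x ≠ 0)
    (hy : y ≠ 0) (hxy : y ≠ x) (hxy' : y ≠ -x) : LinearIndependent F ![x, y] := by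
  rw [LinearIndependent.pair_iff' hx]
  intro a ha
  rcases eq_zero_or_one_or_neg_one_of_card hq a with rfl | rfl | rfl
  · exact hy (by simpa using ha.symm)
  · exact hxy (by simpa using ha.symm)
  · exact hxy' (by simpa using ha.symm)

theorem sum_apply_mul_apply_eq_zero (hq : Fintype.card F = 3) (H : Finset V)
    (hH : ∀ f : Module.Dual F V, 6 ∣ (H.filter fun x => f x ≠ 0).card)
    (f g : Module.Dual F V) : ∑ x ∈ H, f x * g x = 0 := by
  have : Fact (Nat.Prime 3) := ⟨Nat.prime_three⟩
  have : CharP F 3 := charP_of_card_eq_prime hq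
  have h3 : (3 : F) = 0 := by exact_mod_cast CharP.cast_eq_zero F 3
  have hsq : ∀ f : Module.Dual F V, ∑ x ∈ H, f x ^ 2 = 0 := by
    intro f
    obtain ⟨k, hk⟩ := hH f
    have : ∀ x ∈ H, f x ^ 2 = if f x ≠ 0 then 1 else 0 := by
      intro x _
      rcases eq_zero_or_one_or_neg_one_of_card hq (f x) with h | h | h <;> simp [h]
    rw [Finset.sum_congr rfl this, Finset.sum_boole, hk]
    push_cast
    linear_combination 2 * (k : F) * h3
  have h := hsq (f + g)
  simp only [LinearMap.add_apply, add_sq, Finset.sum_add_distrib, hsq, mul_assoc,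
    ← Finset.mul_sum] at h
  linear_combination (∑ x ∈ H, f x * g x) * h3 - h

theorem exists_add_eq_zero_of_card_eq_six (hq : Fintype.card F = 3) (H : Finset V)
    (hneg : ∀ x ∈ H, -x ∈ H)
    (hH : ∀ f : Module.Dual F V, 6 ∣ (H.filter fun x => f x ≠ 0).card)
    (f : Module.Dual F V) (hf : (H.filter fun x => f x ≠ 0).card = 6) :
    ∃ a b c, a + b + c = 0 ∧ a ≠ b ∧ (H.filter fun x => f x = 1) = {a, b, c} := by
  have : Fact (Nat.Prime 3) := ⟨Nat.prime_three⟩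
  have : CharP F 3 := charP_of_card_eq_prime hq
  have h3 : (3 : F) = 0 := by exact_mod_cast CharP.cast_eq_zero F 3
  have hsplit : (H.filter fun x => f x ≠ 0)
      = (H.filter fun x => f x = 1) ∪ (H.filter fun x => f x = -1) := by
    ext x
    rcases eq_zero_or_one_or_neg_one_of_card hq (f x) with h | h | h <;>
      simp +contextual [h]
  have h11 : (1 : F) ≠ -1 := by
    intro h
    exact one_ne_zero (α := F) (by linear_combination h3 - h)
  have hdisj : Disjoint (H.filter fun x => f x = 1) (H.filter fun x => f x = -1) :=
    Finset.disjoint_filter.mpr fun x _ h h' => h11 (h.symm.trans h')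
  have himage : (H.filter fun x => f x = -1) = (H.filter fun x => f x = 1).image Neg.neg := by
    ext x
    simp only [Finset.mem_filter, Finset.mem_image]
    constructor
    · rintro ⟨hx, hfx⟩
      exact ⟨-x, ⟨hneg x hx, by simp [hfx]⟩, neg_neg x⟩
    · rintro ⟨y, ⟨hy, hfy⟩, rfl⟩
      exact ⟨hneg y hy, by simp [hfy]⟩
  rw [hsplit, Finset.card_union_of_disjoint hdisj, himage,
    Finset.card_image_of_injective _ neg_injective] at hf
  obtain ⟨a, b, c, hab, hac, hbc, hA⟩ := Finset.card_eq_three.mp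
    (show (H.filter fun x => f x = 1).card = 3 by omega)
  refine ⟨a, b, c, ?_, hab, hA⟩
  rw [← Module.forall_dual_apply_eq_zero_iff F]
  intro g
  have h := sum_apply_mul_apply_eq_zero hq H hH f g
  rw [← Finset.sum_filter_of_ne (p := fun x => f x ≠ 0)
    (fun x _ hx => left_ne_zero_of_mul hx), hsplit, Finset.sum_union hdisj, himage,
    Finset.sum_image neg_injective.injOn] at h
  simp only [map_neg, neg_mul_neg] at h
  have hsum : ∑ x ∈ H.filter (fun x => f x = 1), f x * g x = g (a + b + c) := by
    rw [Finset.sum_congr rfl (g := fun x => g x)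
      (fun x hx => by rw [(Finset.mem_filter.mp hx).2, one_mul]), hA,
      Finset.sum_insert (by simp [hab, hac]), Finset.sum_pair hbc]
    simp [add_assoc]
  rw [hsum] at h
  linear_combination g (a + b + c) * h3 - h

variable [Fintype V]

theorem six_dvd_card_apply_ne_zero (hq : Fintype.card F = 3)
    (hV : 2 ≤ Module.finrank F V) (f : Module.Dual F V) :
    6 ∣ (Finset.univ.filter fun v => f v ≠ 0).card := by
  by_cases hf : f = 0
  · simp [hf]
  · have hk := Module.Dual.finrank_ker_add_one_of_ne_zero hf
    have h1 : (Finset.univ.filter fun v => f v = 0).card = 3 ^ Module.finrank F f.ker := by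
      rw [← hq, ← Module.card_eq_pow_finrank (K := F) (V := f.ker), ← Fintype.card_subtype]
      exact Fintype.card_congr (Equiv.subtypeEquivRight fun v => by simp)
    have h2 := Finset.card_filter_add_card_filter_not (s := Finset.univ) fun v : V => f v = 0
    rw [Finset.card_univ, Module.card_eq_pow_finrank (K := F) (V := V), hq, h1, ← hk] at h2
    obtain ⟨k, hk'⟩ : ∃ k, Module.finrank F f.ker = k + 1 :=
      Nat.exists_eq_add_one.mpr (by omega)
    rw [hk'] at h2
    refine ⟨3 ^ k, ?_⟩
    rw [pow_succ (n := k + 1), pow_succ] at h2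
    simp only [ne_eq]
    omega

variable [Fintype (Module.Dual F V)]

theorem card_forall_apply_eq_zero (hq : Fintype.card F = 3) (hV : Module.finrank F V = 6)
    (p : Submodule F V) :
    (Finset.univ.filter fun f : Module.Dual F V => ∀ x ∈ p, f x = 0).card
      = 3 ^ (6 - Module.finrank F p) := by
  have h := Subspace.finrank_add_finrank_dualAnnihilator_eq p
  have : 6 - Module.finrank F p = Module.finrank F p.dualAnnihilator := by omega
  rw [this, ← hq, ← Module.card_eq_pow_finrank (K := F) (V := p.dualAnnihilator),
    ← Fintype.card_subtype]
  exact Fintype.card_congr (Equiv.subtypeEquivRight fun f => by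
    simp [Submodule.mem_dualAnnihilator])

theorem card_apply_eq_zero (hq : Fintype.card F = 3) (hV : Module.finrank F V = 6)
    {x : V} (hx : x ≠ 0) :
    (Finset.univ.filter fun f : Module.Dual F V => f x = 0).card = 243 := by
  have h := card_forall_apply_eq_zero hq hV (Submodule.span F {x})
  rw [finrank_span_singleton hx] at h
  convert h using 3 with f
  constructor
  · rintro h0 z hz
    obtain ⟨a, rfl⟩ := Submodule.mem_span_singleton.mp hz
    simp [h0]
  · exact fun h => h x (Submodule.mem_span_singleton_self x)
  · norm_num

theorem card_apply_eq_zero_and (hq : Fintype.card F = 3) (hV : Module.finrank F V = 6)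
    {x y : V} (hxy : LinearIndependent F ![x, y]) :
    (Finset.univ.filter fun f : Module.Dual F V => f x = 0 ∧ f y = 0).card = 81 := by
  have h := card_forall_apply_eq_zero hq hV (Submodule.span F (Set.range ![x, y]))
  rw [finrank_span_eq_card hxy, Fintype.card_fin] at h
  convert h using 3 with f
  constructor
  · rintro ⟨h1, h2⟩ z hz
    have : z ∈ Submodule.span F {x, y} := by simpa [Set.pair_comm] using hz
    obtain ⟨a, b, rfl⟩ := Submodule.mem_span_pair.mp this
    simp [h1, h2]
  · intro h
    exact ⟨h x (Submodule.subset_span ⟨0, rfl⟩), h y (Submodule.subset_span ⟨1, rfl⟩)⟩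
  · norm_num

theorem le_card_apply_eq_zero_and_and (hq : Fintype.card F = 3) (hV : Module.finrank F V = 6)
    (x y z : V) :
    27 ≤ (Finset.univ.filter fun f : Module.Dual F V => f x = 0 ∧ f y = 0 ∧ f z = 0).card := by
  have h := card_forall_apply_eq_zero hq hV (Submodule.span F (Set.range ![x, y, z]))
  have hr : Module.finrank F (Submodule.span F (Set.range ![x, y, z])) ≤ 3 :=
    (finrank_range_le_card _).trans (by simp)
  calc 27 = 3 ^ 3 := by norm_num
    _ ≤ 3 ^ (6 - Module.finrank F (Submodule.span F (Set.range ![x, y, z]))) :=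
      Nat.pow_le_pow_right (by norm_num) (by omega)
    _ = _ := h.symm
    _ ≤ _ := Finset.card_le_card fun f hf => by
      simp only [Finset.mem_filter, Finset.mem_univ, true_and] at hf ⊢
      exact ⟨hf x (Submodule.subset_span ⟨0, rfl⟩), hf y (Submodule.subset_span ⟨1, rfl⟩),
        hf z (Submodule.subset_span ⟨2, rfl⟩)⟩

theorem card_apply_ne_zero (hq : Fintype.card F = 3) (hV : Module.finrank F V = 6)
    {x : V} (hx : x ≠ 0) :
    (Finset.univ.filter fun f : Module.Dual F V => f x ≠ 0).card = 486 := by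
  have h1 := card_apply_eq_zero hq hV hx
  have h2 := Finset.card_filter_add_card_filter_not (s := Finset.univ)
    fun f : Module.Dual F V => f x = 0
  rw [Finset.card_univ, Module.card_eq_pow_finrank (K := F), Subspace.dual_finrank_eq, hV, hq,
    h1] at h2
  simp only [ne_eq]
  omega

theorem card_apply_ne_zero_and (hq : Fintype.card F = 3) (hV : Module.finrank F V = 6)
    {x y : V} (hxy : LinearIndependent F ![x, y]) :
    (Finset.univ.filter fun f : Module.Dual F V => f x ≠ 0 ∧ f y ≠ 0).card = 324 := by
  have h := card_filter_not_and_not (Finset.univ : Finset (Module.Dual F V))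
    (fun f => f x = 0) (fun f => f y = 0)
  rw [Finset.card_univ, Module.card_eq_pow_finrank (K := F), Subspace.dual_finrank_eq, hV, hq,
    card_apply_eq_zero_and hq hV hxy, card_apply_eq_zero hq hV (x := x) (hxy.ne_zero 0),
    card_apply_eq_zero hq hV (x := y) (hxy.ne_zero 1)] at h
  simp only [ne_eq]
  omega

theorem card_apply_eq_zero_and_ne_zero (hq : Fintype.card F = 3) (hV : Module.finrank F V = 6)
    {x y : V} (hxy : LinearIndependent F ![x, y]) :
    (Finset.univ.filter fun f : Module.Dual F V => f x = 0 ∧ f y ≠ 0).card = 162 := by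
  have h := Finset.card_filter_add_card_filter_not
    (s := Finset.univ.filter fun f : Module.Dual F V => f x = 0) fun f => f y = 0
  simp only [Finset.filter_filter] at h
  rw [card_apply_eq_zero_and hq hV hxy, card_apply_eq_zero hq hV (x := x) (hxy.ne_zero 0)] at h
  simp only [ne_eq]
  omega

theorem le_card_apply_eq_zero_and_ne_zero_and_ne_zero
    (hq : Fintype.card F = 3) (hV : Module.finrank F V = 6)
    {x y z : V} (hxy : LinearIndependent F ![x, y]) (hxz : LinearIndependent F ![x, z]) :
    108 ≤ (Finset.univ.filter
      fun f : Module.Dual F V => f x = 0 ∧ f y ≠ 0 ∧ f z ≠ 0).card := by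
  have h := card_filter_not_and_not (Finset.univ.filter fun f : Module.Dual F V => f x = 0)
    (fun f => f y = 0) (fun f => f z = 0)
  simp only [Finset.filter_filter] at h
  rw [card_apply_eq_zero_and hq hV hxy, card_apply_eq_zero_and hq hV hxz,
    card_apply_eq_zero hq hV (x := x) (hxy.ne_zero 0)] at h
  have := le_card_apply_eq_zero_and_and hq hV x y z
  simp only [ne_eq]
  omega


theorem exists_card_apply_ne_zero_eq_six (hq : Fintype.card F = 3)
    (hV : Module.finrank F V = 6) (H : Finset V) (h0 : 0 ∉ H)
    (hH : ∀ f : Module.Dual F V, 6 ∣ (H.filter fun x => f x ≠ 0).card)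
    (hne : H.Nonempty) (hcard : H.card ≤ 16) :
    ∃ f : Module.Dual F V, (H.filter fun x => f x ≠ 0).card = 6 := by
  obtain ⟨x, hx⟩ := hne
  have hx0 : x ≠ 0 := fun h => h0 (h ▸ hx)
  by_contra! hcon
  have hlow : ∀ f ∈ Finset.univ.filter (fun f : Module.Dual F V => f x ≠ 0),
      12 ≤ (H.filter fun y => f y ≠ 0).card := by
    intro f hf
    have hpos : 0 < (H.filter fun y => f y ≠ 0).card :=
      Finset.card_pos.mpr ⟨x, Finset.mem_filter.mpr ⟨hx, (Finset.mem_filter.mp hf).2⟩⟩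
    obtain ⟨k, hk⟩ := hH f
    have := hcon f
    omega
  have hsum := Finset.card_nsmul_le_sum _ _ _ hlow
  rw [card_apply_ne_zero hq hV hx0, smul_eq_mul] at hsum
  have hdouble := Finset.sum_card_bipartiteAbove_eq_sum_card_bipartiteBelow
    (s := Finset.univ.filter fun f : Module.Dual F V => f x ≠ 0) (t := H)
    (fun f y => f y ≠ 0)
  simp only [Finset.bipartiteAbove, Finset.bipartiteBelow, Finset.filter_filter] at hdouble
  rw [hdouble] at hsum
  have hup : ∀ y ∈ H, (Finset.univ.filter fun f : Module.Dual F V => f x ≠ 0 ∧ f y ≠ 0).card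
      ≤ 324 + if y ∈ ({x, -x} : Finset V) then 162 else 0 := by
    intro y hy
    split_ifs with h
    · refine le_of_le_of_eq ?_ (card_apply_ne_zero hq hV hx0)
      exact Finset.card_le_card (Finset.monotone_filter_right _ fun _ _ h => h.1)
    · simp only [Finset.mem_insert, Finset.mem_singleton, not_or] at h
      exact (card_apply_ne_zero_and hq hV (linearIndependent_pair_of_ne hq hx0
        (fun h => h0 (h ▸ hy)) h.1 h.2)).le
  have hbound := hsum.trans (Finset.sum_le_sum hup)
  rw [Finset.sum_add_distrib, Finset.sum_const, ← Finset.sum_filter, Finset.sum_const,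
    smul_eq_mul, smul_eq_mul] at hbound
  have hpair : (H.filter fun y => y ∈ ({x, -x} : Finset V)).card ≤ 2 :=
    (Finset.card_le_card fun y hy => (Finset.mem_filter.mp hy).2).trans Finset.card_le_two
  omega

theorem exists_line_subset_of_six_dvd (hq : Fintype.card F = 3)
    (hV : Module.finrank F V = 6) (H : Finset V) (h0 : 0 ∉ H) (hneg : ∀ x ∈ H, -x ∈ H)
    (hH : ∀ f : Module.Dual F V, 6 ∣ (H.filter fun x => f x ≠ 0).card)
    (hcard : H.card = 8 ∨ H.card = 16) :
    ∃ a b, LinearIndependent F ![a, b] ∧ a ∈ H ∧ b ∈ H ∧ a + b ∈ H ∧ a - b ∈ H := by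
  have : Fact (Nat.Prime 3) := ⟨Nat.prime_three⟩
  have : CharP F 3 := charP_of_card_eq_prime hq
  have h3 : (3 : F) = 0 := by exact_mod_cast CharP.cast_eq_zero F 3
  obtain ⟨f, hf⟩ := exists_card_apply_ne_zero_eq_six hq hV H h0 hH
    (Finset.card_pos.mp (by omega)) (by omega)
  obtain ⟨a, b, c, habc, hab, hA⟩ := exists_add_eq_zero_of_card_eq_six hq H hneg hH f hf
  have hmem : ∀ x, x ∈ ({a, b, c} : Finset V) → x ∈ H ∧ f x = 1 := fun x hx =>
    Finset.mem_filter.mp (hA ▸ hx)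
  obtain ⟨haH, hfa⟩ := hmem a (by simp)
  obtain ⟨hbH, hfb⟩ := hmem b (by simp)
  obtain ⟨hcH, hfc⟩ := hmem c (by simp)
  have hc : c = -(a + b) := (neg_eq_of_add_eq_zero_right habc).symm
  have hLI : LinearIndependent F ![a, b] := by
    refine linearIndependent_pair_of_ne hq (fun h => h0 (h ▸ haH)) (fun h => h0 (h ▸ hbH))
      hab.symm fun h => ?_
    rw [h, add_neg_cancel, zero_add] at habc
    exact h0 (habc ▸ hcH)
  refine ⟨a, b, hLI, haH, hbH, by simpa [hc] using hneg c hcH, ?_⟩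
  by_contra hd
  have hd0 : a - b ≠ 0 := sub_ne_zero.mpr hab
  set Y := H.filter fun x => f x = 0 with hY
  have hYcard : Y.card + 6 = H.card := by
    rw [← hf, ← Finset.card_filter_add_card_filter_not (s := H) fun x => f x = 0]
  have hYdvd : ∀ g : Module.Dual F V, g (a - b) = 0 →
      6 ∣ (Y.filter fun x => g x ≠ 0).card := by
    intro g hg
    have hgb : g b = g a := by
      rw [map_sub, sub_eq_zero] at hg
      exact hg.symm
    have hgc : g c = g a := by
      rw [hc, map_neg, map_add, hgb]
      linear_combination -(g a) * h3
    have hga : ∀ x ∈ H, f x ≠ 0 → (g x ≠ 0 ↔ g a ≠ 0) := by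
      have key : ∀ x ∈ H, f x = 1 → g x = g a := by
        intro x hx hfx
        have : x ∈ ({a, b, c} : Finset V) := hA ▸ Finset.mem_filter.mpr ⟨hx, hfx⟩
        simp only [Finset.mem_insert, Finset.mem_singleton] at this
        rcases this with rfl | rfl | rfl
        exacts [rfl, hgb, hgc]
      intro x hx hfx
      rcases eq_zero_or_one_or_neg_one_of_card hq (f x) with h | h | h
      · exact absurd h hfx
      · rw [key x hx h]
      · rw [← key (-x) (hneg x hx) (by simp [h])]
        simp
    have hT : 6 ∣ ((H.filter fun x => f x ≠ 0).filter fun x => g x ≠ 0).card := by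
      by_cases h : g a = 0
      · rw [Finset.filter_false_of_mem]
        · simp
        · intro x hx
          rw [Finset.mem_filter] at hx
          simp [hga x hx.1 hx.2, h]
      · rw [Finset.filter_true_of_mem]
        · simp [hf]
        · intro x hx
          rw [Finset.mem_filter] at hx
          exact (hga x hx.1 hx.2).mpr h
    have hsum := Finset.card_filter_add_card_filter_not
      (s := H.filter fun x => g x ≠ 0) fun x => f x = 0
    rw [Finset.filter_comm, Finset.filter_comm (p := fun x => g x ≠ 0)] at hsum
    exact (Nat.dvd_add_left hT).mp (hsum ▸ hH g)
  have hYLI : ∀ y ∈ Y, LinearIndependent F ![a - b, y] := by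
    intro y hy
    have hyH := (Finset.mem_filter.mp hy).1
    refine linearIndependent_pair_of_ne hq hd0 (fun h => h0 (h ▸ hyH)) (fun h => hd (h ▸ hyH))
      fun h => hd ?_
    rw [← neg_neg (a - b), ← h]
    exact hneg y hyH
  obtain ⟨z, hz⟩ : Y.Nonempty := Finset.card_pos.mp (by omega)
  set D := Finset.univ.filter fun g : Module.Dual F V => g (a - b) = 0 ∧ g z ≠ 0 with hD
  have hDcard : D.card = 162 := card_apply_eq_zero_and_ne_zero hq hV (hYLI z hz)
  have hsix : ∀ g ∈ D, (Y.filter fun y => g y ≠ 0).card = 6 := by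
    intro g hg
    rw [hD, Finset.mem_filter] at hg
    have hpos : 0 < (Y.filter fun y => g y ≠ 0).card :=
      Finset.card_pos.mpr ⟨z, Finset.mem_filter.mpr ⟨hz, hg.2.2⟩⟩
    have hle : (Y.filter fun y => g y ≠ 0).card ≤ Y.card := Finset.card_filter_le _ _
    obtain ⟨k, hk⟩ := hYdvd g hg.2.1
    omega
  have hdouble := Finset.sum_card_bipartiteAbove_eq_sum_card_bipartiteBelow
    (s := D) (t := Y) (fun g y => g y ≠ 0)
  simp only [Finset.bipartiteAbove, Finset.bipartiteBelow] at hdouble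
  rw [Finset.sum_congr rfl hsix, Finset.sum_const, hDcard, smul_eq_mul] at hdouble
  have hlow := Finset.card_nsmul_le_sum Y
    (fun y => (D.filter fun g => g y ≠ 0).card) 108 fun y hy => by
      simp only [hD, Finset.filter_filter, and_assoc]
      exact le_card_apply_eq_zero_and_ne_zero_and_ne_zero hq hV (hYLI z hz) (hYLI y hy)
  rw [← hdouble, smul_eq_mul] at hlow
  have hYle : 6 ≤ Y.card := by
    obtain ⟨g, hg⟩ : D.Nonempty := Finset.card_pos.mp (by omega)
    exact (hsix g hg).symm.le.trans (Finset.card_filter_le _ _)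
  omega

end Counting

section Holes

open Classical

variable {F : Type*} [Field F] [Fintype F] {n : ℕ}

/-- The nonzero vectors on no line of `S`. -/
noncomputable def holes (S : Finset (Submodule F (Fin n → F))) : Finset (Fin n → F) :=
  Finset.univ.filter fun v => v ≠ 0 ∧ ∀ l ∈ S, v ∉ l

theorem card_filter_eq_holes_add_sum {S : Finset (Submodule F (Fin n → F))}
    (hS : IsPartialLineSpread F n S) (P : (Fin n → F) → Prop) [DecidablePred P]
    (hP : ∀ v, P v → v ≠ 0) :
    (Finset.univ.filter P).card
      = ((holes S).filter P).card + ∑ l ∈ S, (Finset.univ.filter fun v => v ∈ l ∧ P v).card := by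
  have hunion : Finset.univ.filter P
      = (holes S).filter P ∪ S.biUnion fun l => Finset.univ.filter fun v => v ∈ l ∧ P v := by
    ext v
    have := hP v
    by_cases h : ∃ l ∈ S, v ∈ l <;> simp [holes] <;> grind
  rw [hunion, Finset.card_union_of_disjoint, Finset.card_biUnion]
  · intro l hl l' hl' hne
    refine Finset.disjoint_filter.mpr fun v _ h h' => hP v h.2 ?_
    have hv : v ∈ l ⊓ l' := ⟨h.1, h'.1⟩
    rwa [hS.2 l hl l' hl' hne, Submodule.mem_bot] at hv
  · rw [Finset.disjoint_left]
    intro v hv hv'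
    simp only [holes, Finset.mem_filter, Finset.mem_univ, true_and, Finset.mem_biUnion]
      at hv hv'
    obtain ⟨l, hl, hvl, -⟩ := hv'
    exact hv.1.2 l hl hvl

theorem card_holes_add (hq : Fintype.card F = 3) {S : Finset (Submodule F (Fin n → F))}
    (hS : IsPartialLineSpread F n S) : (holes S).card + 8 * S.card + 1 = 3 ^ n := by
  have h := card_filter_eq_holes_add_sum hS (fun v => v ≠ 0) fun _ h => h
  have hl : ∀ l ∈ S, (Finset.univ.filter fun v => v ∈ l ∧ v ≠ 0).card = 8 := by
    intro l hl
    have hcard : (Finset.univ.filter fun v => v ∈ l).card = 9 := by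
      rw [← Fintype.card_subtype]
      exact (Module.card_eq_pow_finrank (K := F) (V := l)).trans (by rw [hq, hS.1 l hl]; rfl)
    have herase : (Finset.univ.filter fun v => v ∈ l ∧ v ≠ 0)
        = (Finset.univ.filter fun v => v ∈ l).erase 0 := by
      ext v
      simp [and_comm]
    rw [herase, Finset.card_erase_of_mem (by simp), hcard]
  rw [Finset.sum_congr rfl hl, Finset.sum_const, smul_eq_mul,
    Finset.filter_true_of_mem (s := holes S) (fun v hv => (Finset.mem_filter.mp hv).2.1),
    Finset.filter_ne', Finset.card_erase_of_mem (Finset.mem_univ _), Finset.card_univ,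
    Fintype.card_fun, Fintype.card_fin, hq] at h
  have := Nat.one_le_pow n 3 (by norm_num)
  omega

theorem six_dvd_card_holes_apply_ne_zero (hq : Fintype.card F = 3) (hn : 2 ≤ n)
    {S : Finset (Submodule F (Fin n → F))} (hS : IsPartialLineSpread F n S)
    (f : Module.Dual F (Fin n → F)) : 6 ∣ ((holes S).filter fun v => f v ≠ 0).card := by
  have h := card_filter_eq_holes_add_sum hS (fun v => f v ≠ 0)
    fun v hv h0 => hv (by rw [h0, map_zero])
  have hl : 6 ∣ ∑ l ∈ S, (Finset.univ.filter fun v => v ∈ l ∧ f v ≠ 0).card := by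
    refine Finset.dvd_sum fun l hl => ?_
    have := six_dvd_card_apply_ne_zero hq (hS.1 l hl).ge (f.comp l.subtype)
    rw [← Fintype.card_subtype] at this ⊢
    exact Fintype.card_congr
      (Equiv.subtypeSubtypeEquivSubtypeInter (· ∈ l) fun v => f v ≠ 0) ▸ this
  have htotal := six_dvd_card_apply_ne_zero hq (V := Fin n → F) (by simpa using hn) f
  rw [h] at htotal
  exact (Nat.dvd_add_left hl).mp htotal

theorem IsMaximalPartialLineSpread.ncard_eq_of_lt (hq : Fintype.card F = 3)
    {S : Set (Submodule F (Fin 6 → F))} (hS : IsMaximalPartialLineSpread F 6 S)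
    (hcard : 88 < S.ncard) : S.ncard = 91 := by
  obtain ⟨S, rfl⟩ := S.toFinite.exists_finset_coe
  rw [Set.ncard_coe_finset] at hcard ⊢
  have hcount := card_holes_add hq hS.1
  by_contra hne
  have : Finite (Module.Dual F (Fin 6 → F)) := DFunLike.finite _
  have : Fintype (Module.Dual F (Fin 6 → F)) := Fintype.ofFinite _
  obtain ⟨a, b, hLI, ha, hb, hadd, hsub⟩ := exists_line_subset_of_six_dvd hq
    (by simp) (holes S) (by simp [holes]) (by simp [holes])
    (six_dvd_card_holes_apply_ne_zero hq (by norm_num) hS.1) (by omega)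
  have hrank := finrank_span_eq_card hLI
  rw [Matrix.range_cons_cons_empty, Fintype.card_fin] at hrank
  obtain ⟨l, hl, hinf⟩ := hS.2 _ hrank
  refine hinf ((Submodule.eq_bot_iff _).mpr ?_)
  rintro v ⟨hv, hvl⟩
  have hmem : ∀ x ∈ holes S, x ∉ l ∧ -x ∉ l := by
    intro x hx
    have := (Finset.mem_filter.mp hx).2.2 l hl
    exact ⟨this, by simpa using this⟩
  obtain ⟨s, t, rfl⟩ := Submodule.mem_span_pair.mp hv
  rcases eq_zero_or_one_or_neg_one_of_card hq s with rfl | rfl | rfl <;>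
    rcases eq_zero_or_one_or_neg_one_of_card hq t with rfl | rfl | rfl <;>
    have h1 := hmem _ ha <;> have h2 := hmem _ hb <;> have h3 := hmem _ hadd <;>
    have h4 := hmem _ hsub <;>
    simp_all [sub_eq_add_neg, add_comm]

end Holes

section Example

/-- The vector of `F ^ 6` whose coordinates are the base-3 digits of `c`, over a field of
characteristic 3. -/
def digitVec (F : Type*) [Field F] (c : ℕ) : Fin 6 → F := fun i => ((c / 3 ^ (i : ℕ) : ℕ) : F)

/-- The number below `3 ^ 6` whose base-3 digits are those of `s * l.1 + t * l.2`, taken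
digitwise modulo 3. -/
def digitComb (l : ℕ × ℕ) (s t : ℕ) : ℕ :=
  (s * l.1 + t * l.2) % 3 + 3 * ((s * (l.1 / 3) + t * (l.2 / 3)) % 3)
    + 9 * ((s * (l.1 / 9) + t * (l.2 / 9)) % 3) + 27 * ((s * (l.1 / 27) + t * (l.2 / 27)) % 3)
    + 81 * ((s * (l.1 / 81) + t * (l.2 / 81)) % 3)
    + 243 * ((s * (l.1 / 243) + t * (l.2 / 243)) % 3)

/-- The digit codes of the nonzero vectors on the line spanned by the pair of codes `l`. -/
def lineCodes (l : ℕ × ℕ) : List ℕ :=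
  [digitComb l 0 1, digitComb l 0 2, digitComb l 1 0, digitComb l 1 1, digitComb l 1 2,
    digitComb l 2 0, digitComb l 2 1, digitComb l 2 2]

/-- Pairs of digit codes spanning 88 pairwise skew lines of `PG(5,3)`: eight orbits of a
collineation of order 11 which permutes `holeCodes`. -/
def spreadCodes : List (ℕ × ℕ) :=
  [(324, 516), (446, 223), (560, 669), (49, 601), (147, 469), (441, 638), (554, 256), (4,
   242), (12, 726), (36, 529), (108, 172), (567, 489), (403, 142), (332, 426), (434, 671),
   (524, 598), (184, 460), (552, 611), (7, 418), (21, 728), (63, 526), (189, 163), (270, 343),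
   (41, 422), (123, 704), (369, 562), (257, 28), (236, 84), (708, 252), (556, 230), (10, 690),
   (30, 664), (90, 577), (513, 576), (241, 349), (723, 413), (520, 677), (226, 724), (678,
   514), (709, 235), (550, 705), (19, 547), (57, 64), (171, 192), (594, 651), (484, 628),
   (575, 307), (391, 152), (404, 456), (326, 491), (443, 139), (551, 417), (22, 725), (66,
   517), (198, 217), (279, 439), (68, 521), (204, 229), (612, 687), (457, 655), (494, 631),
   (148, 262), (444, 179), (563, 537), (31, 205), (93, 615), (675, 670), (727, 595), (523,
   478), (181, 584), (543, 337), (61, 485), (183, 569), (549, 400), (25, 350), (75, 407),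
   (225, 686), (657, 220), (592, 660), (361, 574), (314, 388), (137, 395), (411, 380), (680,
   362), (706, 308), (541, 146), (73, 438), (219, 518)]

/-- The digit codes of the nonzero vectors on the 12 points missed by the lines of
`spreadCodes`; these points are the columns of a generator matrix of the extended ternary
Golay code. -/
def holeCodes : List ℕ :=
  [1, 3, 9, 27, 81, 160, 243, 355, 421, 480, 553, 694].flatMap fun a => [a, digitComb (a, 0) 2 0]

theorem digitComb_lt (l : ℕ × ℕ) (s t : ℕ) : digitComb l s t < 729 := by
  unfold digitComb
  omega

/-- The number whose binary digits are the indicator of the list `L`. -/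
def bitMask (L : List ℕ) : ℕ := L.foldr (fun c m => 2 ^ c ||| m) 0

theorem testBit_bitMask (L : List ℕ) (c : ℕ) : (bitMask L).testBit c ↔ c ∈ L := by
  induction L with
  | nil => simp [bitMask]
  | cons a L ih =>
    have h : bitMask (a :: L) = 2 ^ a ||| bitMask L := rfl
    rw [h, Nat.testBit_or, Nat.testBit_two_pow, Bool.or_eq_true, ih, List.mem_cons,
      decide_eq_true_iff, eq_comm]

/-- All digit codes: zero, the holes, and the vectors on the lines. -/
def allCodes : List ℕ := 0 :: (holeCodes ++ spreadCodes.flatMap lineCodes)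

theorem mem_allCodes (c : ℕ) : c ∈ allCodes ↔ c < 729 := by
  have h : bitMask allCodes = 2 ^ 729 - 1 := by decide +kernel
  rw [← testBit_bitMask, h, Nat.testBit_two_pow_sub_one, decide_eq_true_iff]

theorem nodup_allCodes : allCodes.Nodup := by
  have h : allCodes.toFinset = Finset.range 729 := by
    ext c
    simp [mem_allCodes]
  have hlen : allCodes.length = 729 := by decide +kernel
  rw [← Multiset.coe_nodup, ← Multiset.toFinset_card_eq_card_iff_nodup]
  simpa [hlen] using congrArg Finset.card h

theorem zero_notMem_lineCodes {l : ℕ × ℕ} (hl : l ∈ spreadCodes) : 0 ∉ lineCodes l := by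
  intro h
  refine (List.nodup_cons.mp nodup_allCodes).1 ?_
  exact List.mem_append_right _ (List.mem_flatMap.mpr ⟨l, hl, h⟩)

theorem disjoint_lineCodes {l l' : ℕ × ℕ} (hl : l ∈ spreadCodes) (hl' : l' ∈ spreadCodes)
    (hne : l ≠ l') : (lineCodes l).Disjoint (lineCodes l') := by
  have h := (List.nodup_flatMap.mp (List.nodup_cons.mp nodup_allCodes).2.of_append_right).2
  have : Std.Symm (Function.onFun List.Disjoint lineCodes) := ⟨fun _ _ h => h.symm⟩
  exact h.forall hl hl' hne

theorem digitComb_notMem_holeCodes : ∀ a ∈ holeCodes, ∀ b ∈ holeCodes, a ≠ b →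
    digitComb (a, b) 1 1 ∉ holeCodes := by
  decide +kernel

theorem length_spreadCodes : spreadCodes.length = 88 := by
  decide

theorem nodup_spreadCodes : spreadCodes.Nodup := by
  decide +kernel

theorem digitVec_zero (F : Type*) [Field F] : digitVec F 0 = 0 := by
  ext i
  simp [digitVec]

variable {F : Type*} [Field F] [CharP F 3]

theorem digitVec_digitComb (l : ℕ × ℕ) (s t : ℕ) :
    digitVec F (digitComb l s t) = (s : F) • digitVec F l.1 + (t : F) • digitVec F l.2 := by
  ext i
  simp only [digitVec, Pi.add_apply, Pi.smul_apply, smul_eq_mul]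
  rw [← Nat.cast_mul, ← Nat.cast_mul, ← Nat.cast_add, CharP.natCast_eq_natCast F 3, Nat.ModEq]
  unfold digitComb
  fin_cases i <;> norm_num <;> omega

theorem digitVec_injOn {a b : ℕ} (ha : a < 729) (hb : b < 729)
    (h : digitVec F a = digitVec F b) : a = b := by
  have key : ∀ i : Fin 6, a / 3 ^ (i : ℕ) % 3 = b / 3 ^ (i : ℕ) % 3 := fun i =>
    (CharP.natCast_eq_natCast F 3).mp (congrFun h i)
  have h0 := key 0
  have h1 := key 1
  have h2 := key 2
  have h3 := key 3
  have h4 := key 4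
  have h5 := key 5
  norm_num at h0 h1 h2 h3 h4 h5
  omega

theorem exists_digitVec_eq [Fintype F] (hq : Fintype.card F = 3) (w : Fin 6 → F) :
    ∃ c < 729, digitVec F c = w := by
  classical
  have hbij : Function.Bijective fun c : Fin 729 => digitVec F c := by
    rw [Fintype.bijective_iff_injective_and_card]
    refine ⟨fun a b h => Fin.ext (digitVec_injOn a.2 b.2 h), ?_⟩
    simp [hq]
  obtain ⟨c, hc⟩ := hbij.2 w
  exact ⟨c, c.2, hc⟩

/-- The line of `PG(5,3)` spanned by a pair of digit codes. -/
def codeLine (F : Type*) [Field F] (l : ℕ × ℕ) : Submodule F (Fin 6 → F) :=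
  Submodule.span F {digitVec F l.1, digitVec F l.2}

theorem digitVec_mem_codeLine {l : ℕ × ℕ} {c : ℕ} (hc : c ∈ lineCodes l) :
    digitVec F c ∈ codeLine F l := by
  have h : ∀ s t, digitVec F (digitComb l s t) ∈ codeLine F l := fun s t =>
    Submodule.mem_span_pair.mpr ⟨s, t, (digitVec_digitComb l s t).symm⟩
  simp only [lineCodes, List.mem_cons, List.not_mem_nil, or_false] at hc
  rcases hc with rfl | rfl | rfl | rfl | rfl | rfl | rfl | rfl <;> exact h _ _

theorem exists_lineCodes_of_mul_add [Fintype F] (hq : Fintype.card F = 3) (l : ℕ × ℕ)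
    {s t : F} (hst : s ≠ 0 ∨ t ≠ 0) :
    ∃ c ∈ lineCodes l, digitVec F c = s • digitVec F l.1 + t • digitVec F l.2 := by
  have key : ∀ a : F, ∃ n : ℕ, n < 3 ∧ (n : F) = a := by
    have h3 : (3 : F) = 0 := by exact_mod_cast CharP.cast_eq_zero F 3
    intro a
    rcases eq_zero_or_one_or_neg_one_of_card hq a with rfl | rfl | rfl
    · exact ⟨0, by simp⟩
    · exact ⟨1, by simp⟩
    · exact ⟨2, by norm_num, by push_cast; linear_combination h3⟩
  obtain ⟨m, hm, rfl⟩ := key s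
  obtain ⟨n, hn, rfl⟩ := key t
  refine ⟨digitComb l m n, ?_, digitVec_digitComb l m n⟩
  interval_cases m <;> interval_cases n <;> simp [lineCodes] at hst ⊢

theorem exists_mem_lineCodes_of_mem_codeLine [Fintype F] (hq : Fintype.card F = 3)
    {l : ℕ × ℕ} {w : Fin 6 → F} (hw : w ∈ codeLine F l) (hw0 : w ≠ 0) :
    ∃ c ∈ lineCodes l, digitVec F c = w := by
  obtain ⟨s, t, rfl⟩ := Submodule.mem_span_pair.mp hw
  refine exists_lineCodes_of_mul_add hq l ?_
  by_contra! h
  simp [h.1, h.2] at hw0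

theorem lt_of_mem_lineCodes {l : ℕ × ℕ} {c : ℕ} (hc : c ∈ lineCodes l) : c < 729 := by
  simp only [lineCodes, List.mem_cons, List.not_mem_nil, or_false] at hc
  rcases hc with rfl | rfl | rfl | rfl | rfl | rfl | rfl | rfl <;> exact digitComb_lt _ _ _

theorem linearIndependent_digitVec [Fintype F] (hq : Fintype.card F = 3)
    {l : ℕ × ℕ} (hl : l ∈ spreadCodes) :
    LinearIndependent F ![digitVec F l.1, digitVec F l.2] := by
  rw [LinearIndependent.pair_iff]
  intro s t hst
  by_contra h
  obtain ⟨c, hc, hcv⟩ := exists_lineCodes_of_mul_add hq l (not_and_or.mp h)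
  rw [hst, ← digitVec_zero] at hcv
  have := digitVec_injOn (lt_of_mem_lineCodes hc) (by norm_num) hcv
  exact zero_notMem_lineCodes hl (this ▸ hc)

theorem finrank_codeLine [Fintype F] (hq : Fintype.card F = 3)
    {l : ℕ × ℕ} (hl : l ∈ spreadCodes) : Module.finrank F (codeLine F l) = 2 := by
  have h := finrank_span_eq_card (linearIndependent_digitVec (F := F) hq hl)
  rwa [Matrix.range_cons_cons_empty, Fintype.card_fin] at h

theorem codeLine_inf_codeLine [Fintype F] (hq : Fintype.card F = 3) {l l' : ℕ × ℕ}
    (hl : l ∈ spreadCodes) (hl' : l' ∈ spreadCodes) (hne : l ≠ l') :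
    codeLine F l ⊓ codeLine F l' = ⊥ := by
  rw [Submodule.eq_bot_iff]
  rintro w ⟨hw, hw'⟩
  by_contra hw0
  obtain ⟨c, hc, hcw⟩ := exists_mem_lineCodes_of_mem_codeLine hq hw hw0
  obtain ⟨c', hc', hcw'⟩ := exists_mem_lineCodes_of_mem_codeLine hq hw' hw0
  have := digitVec_injOn (lt_of_mem_lineCodes hc) (lt_of_mem_lineCodes hc')
    (hcw.trans hcw'.symm)
  exact disjoint_lineCodes hl hl' hne hc (this ▸ hc')

theorem isMaximalPartialLineSpread_codeLine [Fintype F] (hq : Fintype.card F = 3) :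
    IsMaximalPartialLineSpread F 6 (Set.image (codeLine F) {l | l ∈ spreadCodes}) := by
  refine ⟨⟨?_, ?_⟩, ?_⟩
  · rintro _ ⟨l, hl, rfl⟩
    exact finrank_codeLine hq hl
  · rintro _ ⟨l, hl, rfl⟩ _ ⟨l', hl', rfl⟩ hne
    exact codeLine_inf_codeLine hq hl hl' fun h => hne (h ▸ rfl)
  · intro m hm
    by_contra! hcon
    have hhole : ∀ w ∈ m, w ≠ 0 → ∃ c ∈ holeCodes, c < 729 ∧ digitVec F c = w := by
      intro w hw hw0
      obtain ⟨c, hc, rfl⟩ := exists_digitVec_eq hq w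
      refine ⟨c, ?_, hc, rfl⟩
      have hmem := (mem_allCodes c).mpr hc
      rw [allCodes, List.mem_cons, List.mem_append, List.mem_flatMap] at hmem
      rcases hmem with rfl | h | ⟨l, hl, h⟩
      · exact absurd (digitVec_zero F) hw0
      · exact h
      · have hbot : digitVec F c ∈ m ⊓ codeLine F l := ⟨hw, digitVec_mem_codeLine h⟩
        rw [hcon _ ⟨l, hl, rfl⟩] at hbot
        exact absurd hbot hw0
    have B := Module.finBasisOfFinrankEq F m hm
    have hadd : B 0 + B 1 ≠ 0 := by
      intro h
      have := Fintype.linearIndependent_iff.mp B.linearIndependent (fun _ => 1)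
        (by simpa [Fin.sum_univ_two] using h) 0
      exact one_ne_zero this
    obtain ⟨a, ha, -, hav⟩ := hhole (B 0) (B 0).2 (by simpa using B.ne_zero 0)
    obtain ⟨b, hb, -, hbv⟩ := hhole (B 1) (B 1).2 (by simpa using B.ne_zero 1)
    obtain ⟨c, hc, hclt, hcv⟩ := hhole (B 0 + B 1 : m) (B 0 + B 1).2 fun h => hadd (Subtype.ext h)
    have hab : a ≠ b := by
      rintro rfl
      have : B 0 = B 1 := Subtype.ext (hav.symm.trans hbv)
      exact absurd (B.injective this) (by decide)
    have hcab : digitComb (a, b) 1 1 = c := by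
      refine digitVec_injOn (F := F) (digitComb_lt _ _ _) hclt ?_
      rw [digitVec_digitComb, hcv, hav, hbv]
      simp
    exact digitComb_notMem_holeCodes a ha b hb hab (hcab ▸ hc)

theorem ncard_codeLine_image [Fintype F] (hq : Fintype.card F = 3) :
    (Set.image (codeLine F) {l | l ∈ spreadCodes}).ncard = 88 := by
  rw [Set.InjOn.ncard_image]
  · have : {l | l ∈ spreadCodes} = (spreadCodes.toFinset : Set (ℕ × ℕ)) := by
      ext
      simp
    rw [this, Set.ncard_coe_finset, List.toFinset_card_of_nodup nodup_spreadCodes,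
      length_spreadCodes]
  · intro l hl l' hl' h
    by_contra hne
    have hinf := codeLine_inf_codeLine (F := F) hq hl hl' hne
    have hrank := finrank_codeLine (F := F) hq hl
    rw [← h, inf_idem] at hinf
    rw [hinf, finrank_bot] at hrank
    omega

end Example

/-- In PG(5,3), the largest maximal partial line spread that is not a spread
has size 88: there is a maximal partial line spread of size 88, and every
maximal partial line spread of size greater than 88 has size 91 (a spread). -/
theorem stmt7 (F : Type*) [Field F] [Fintype F] (hq : Fintype.card F = 3) :
    (∃ S : Set (Submodule F (Fin 6 → F)),
      IsMaximalPartialLineSpread F 6 S ∧ S.ncard = 88) ∧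
    (∀ S : Set (Submodule F (Fin 6 → F)),
      IsMaximalPartialLineSpread F 6 S → 88 < S.ncard → S.ncard = 91) := by
  have : Fact (Nat.Prime 3) := ⟨Nat.prime_three⟩
  have : CharP F 3 := charP_of_card_eq_prime hq
  exact ⟨⟨_, isMaximalPartialLineSpread_codeLine hq, ncard_codeLine_image hq⟩,
    fun _ hS hcard => hS.ncard_eq_of_lt hq hcard⟩
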